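/- The Random-Push algorithm maintains an MRU(4) tree in expectation: for every request sequence σ and every time t, the expected depth of the item of rank r at time t in Random-Push's tree satisfies E[D(r)] < log₂ r + 3 (and hence E[D(r)] < ⌊log₂ r⌋ + 4). -/

import Mathlib

/-!
Model: `n` items (elements of `Fin n`) are stored, one per server, on the `n`
servers of a fixed complete binary tree.  Servers are indexed in heap order by
`Fin n` (server `s` has heap index `s + 1`); the root (index `0`) has depth `0`.
A configuration is a bijection `Fin n ≃ Fin n` from items to servers; the depth
of an item is the depth of its hosting server.
-/

/-- Depth of the server with 0-based heap index `s` in the complete binary tree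
(the root, index `0`, has depth `0`). -/
def sDepth {n : ℕ} (s : Fin n) : ℕ := Nat.log 2 (s.val + 1)

/-- The parent server of `s` in the complete binary tree (the root is its own parent). -/
def sParent {n : ℕ} (s : Fin n) : Fin n :=
  ⟨(s.val + 1) / 2 - 1, by
    have h := Nat.div_le_self (s.val + 1) 2
    have h2 := s.isLt
    omega⟩

/-- Apply a list of swaps to a configuration (a bijection from items to servers):
each swap exchanges the item at the given server with the item at its parent server,
at unit cost per swap. -/
def applySwaps {n : ℕ} (l : List (Fin n)) (c : Fin n ≃ Fin n) : Fin n ≃ Fin n :=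
  l.foldl (fun c s => c.trans (Equiv.swap s (sParent s))) c

/-- The rank of item `v` at time `t` (the number of distinct items requested since the
last request to `v` prior to `t`, including `v`): upon a request to an item its rank
becomes `1`, the ranks of items with smaller rank increase by one, and all other ranks
are unchanged.  Initially the ranks are induced by the bijection `r0`
(`itemRank r0 σ 0 v = r0 v + 1`, a permutation of `1, …, n`). -/
def itemRank {n : ℕ} (r0 : Fin n ≃ Fin n) (σ : ℕ → Fin n) : ℕ → Fin n → ℕ
  | 0 => fun v => (r0 v).val + 1
  | t + 1 => fun v =>
      if v = σ t then 1
      else if itemRank r0 σ t v < itemRank r0 σ t (σ t) then itemRank r0 σ t v + 1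
      else itemRank r0 σ t v

/-- The child of server `s` in the complete binary tree: `2s + 1` (left, `b = false`)
or `2s + 2` (right, `b = true`); returns `s` itself if the child index is out of range
(which never happens for servers above the last level of a complete tree). -/
def rpChild {n : ℕ} (s : Fin n) (b : Bool) : Fin n :=
  if h : 2 * s.val + (if b then 2 else 1) < n then
    ⟨2 * s.val + (if b then 2 else 1), h⟩
  else s

/-- The random root-to-bottom path determined by the coin flips `flips`:
it starts at the root and at each server steps to one of its two children
according to the next coin flip. -/
def rpPath {n : ℕ} (hpos : 0 < n) (flips : ℕ → Bool) : ℕ → Fin n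
  | 0 => ⟨0, hpos⟩
  | j + 1 => rpChild (rpPath hpos flips j) (flips j)

/-- One step of the Random-Push (Push-Down Tree) algorithm, serving a request to item
`u` hosted at server `s = c u` at depth `d`: `u` moves to the root, the items on the
random root-to-depth-`d` path determined by `flips` (starting with the former root
item) are shifted down one level along the path, and the item at the end of the path
moves to `s`.  The resulting relocation of items is the cyclic permutation of servers
`root → p 1 → ⋯ → p d → s → root`, given by `List.formPerm` of the path. -/
def rpStep {n : ℕ} (hpos : 0 < n) (flips : ℕ → Bool) (u : Fin n)
    (c : Fin n ≃ Fin n) : Fin n ≃ Fin n :=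
  c.trans (List.formPerm
    (((List.range (sDepth (c u) + 1)).map (rpPath hpos flips)) ++ [c u]))

/-- The (random) configuration of the Random-Push algorithm at each time, starting
from the initial configuration `c0`, serving the request sequence `σ`, with coin
flips `ω t` used when serving the request at time `t`. -/
def rpConf {n : ℕ} (hpos : 0 < n) (c0 : Fin n ≃ Fin n) (σ : ℕ → Fin n)
    (ω : ℕ → ℕ → Bool) : ℕ → Fin n ≃ Fin n
  | 0 => c0
  | t + 1 => rpStep hpos (ω t) (σ t) (rpConf hpos c0 σ ω t)

/-- Extend a finite table of fair coin flips (`m` time steps, at most `K` flips per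
step — enough for a complete tree of `2^K - 1` servers) to a total function. -/
def extendFlips (m K : ℕ) (ω : Fin m → Fin K → Bool) : ℕ → ℕ → Bool :=
  fun t j => if h : t < m ∧ j < K then ω ⟨t, h.1⟩ ⟨j, h.2⟩ else false

lemma depth_lt_of_full_tree {n K : ℕ} (hn : n = 2 ^ K - 1) (s : Fin n) : sDepth s < K := by
  have h := s.isLt
  exact Nat.log_lt_of_lt_pow (by omega) (by omega)

lemma rpPath_val_bounds {n K : ℕ} (hn : n = 2 ^ K - 1) (hpos : 0 < n) (f : ℕ → Bool) {j : ℕ}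
    (hj : j < K) :
    2 ^ j ≤ (rpPath hpos f j).val + 1 ∧ (rpPath hpos f j).val + 1 < 2 ^ (j + 1) := by
  induction j with
  | zero => simp [rpPath]
  | succ j ih =>
    obtain ⟨h1, h2⟩ := ih (by omega)
    have h3 : 2 ^ (j + 1 + 1) ≤ 2 ^ K := Nat.pow_le_pow_right (by norm_num) hj
    rw [pow_succ] at *
    simp only [rpPath, rpChild]
    cases f j <;> simp <;> rw [dif_pos (by omega)] <;> simp <;> omega

lemma sDepth_rpPath {n K : ℕ} (hn : n = 2 ^ K - 1) (hpos : 0 < n) (f : ℕ → Bool) {j : ℕ}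
    (hj : j < K) : sDepth (rpPath hpos f j) = j := by
  obtain ⟨h1, h2⟩ := rpPath_val_bounds hn hpos f hj
  exact (Nat.log_eq_iff (Or.inr ⟨by norm_num, by omega⟩)).2 ⟨h1, h2⟩

lemma rpPath_succ_val {n K : ℕ} (hn : n = 2 ^ K - 1) (hpos : 0 < n) (f : ℕ → Bool) {j : ℕ}
    (hj : j + 1 < K) :
    (rpPath hpos f (j + 1)).val = 2 * (rpPath hpos f j).val + (if f j then 2 else 1) := by
  obtain ⟨h1, h2⟩ := rpPath_val_bounds hn hpos f (j := j) (by omega)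
  have h3 : 2 ^ (j + 1 + 1) ≤ 2 ^ K := Nat.pow_le_pow_right (by norm_num) hj
  rw [pow_succ] at h3
  simp only [rpPath, rpChild]
  rw [dif_pos (by split <;> omega)]

/-- A server at depth `d` is hit by the random path exactly when the first `d` flips
agree with a fixed word. -/
lemma exists_word_rpPath_eq_iff {n K : ℕ} (hn : n = 2 ^ K - 1) (hpos : 0 < n) (d : ℕ) :
    ∀ s : Fin n, sDepth s = d →
      ∃ β : ℕ → Bool, ∀ f : ℕ → Bool, rpPath hpos f d = s ↔ ∀ j < d, f j = β j := by
  induction d with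
  | zero =>
    intro s hs
    refine ⟨fun _ => false, fun f => ?_⟩
    simp only [sDepth, Nat.log_eq_zero_iff] at hs
    simp only [rpPath, Fin.ext_iff, not_lt_zero, false_implies, implies_true, iff_true]
    omega
  | succ d ih =>
    intro s hs
    have hdK : d + 1 < K := hs ▸ depth_lt_of_full_tree hn s
    have hbd := (Nat.log_eq_iff (Or.inr ⟨by norm_num, by omega⟩)).1 hs
    have h1 : 1 ≤ 2 ^ d := Nat.one_le_two_pow
    simp only [pow_succ] at hbd
    have hs' : (s.val - 1) / 2 < n := by omega
    obtain ⟨β, hβ⟩ := ih ⟨(s.val - 1) / 2, hs'⟩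
      ((Nat.log_eq_iff (Or.inr ⟨by norm_num, by omega⟩)).2 (by simp only [pow_succ]; omega))
    refine ⟨fun j => if j < d then β j else decide (s.val % 2 = 0), fun f => ?_⟩
    rw [Nat.forall_lt_succ_right]
    have hcongr : (∀ j < d, f j = if j < d then β j else decide (s.val % 2 = 0)) ↔
        ∀ j < d, f j = β j :=
      forall₂_congr fun j hj => by rw [if_pos hj]
    rw [hcongr, ← hβ f, Fin.ext_iff, Fin.ext_iff, rpPath_succ_val hn hpos f hdK]
    cases f d <;> simp <;> omega

/-- The coin flips of one request, extended by `false` to a total function. -/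
def flipRow (K : ℕ) (η : Fin K → Bool) : ℕ → Bool :=
  fun j => if h : j < K then η ⟨j, h⟩ else false

lemma card_flips_rpPath_eq {n K : ℕ} (hn : n = 2 ^ K - 1) (hpos : 0 < n) (s : Fin n) :
    (Finset.univ.filter fun η : Fin K → Bool =>
      rpPath hpos (flipRow K η) (sDepth s) = s).card = 2 ^ (K - sDepth s) := by
  obtain ⟨β, hβ⟩ := exists_word_rpPath_eq_iff hn hpos _ s rfl
  have hd := depth_lt_of_full_tree hn s
  have hset : (Finset.univ.filter fun η : Fin K → Bool =>
      rpPath hpos (flipRow K η) (sDepth s) = s) =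
      Fintype.piFinset fun j : Fin K => if j.val < sDepth s then {β j} else Finset.univ := by
    ext η
    simp only [Finset.mem_filter_univ, hβ, Fintype.mem_piFinset, flipRow]
    constructor
    · intro h j
      split
      · rename_i hj
        simpa using h j hj
      · simp
    · intro h j hj
      have := h ⟨j, hj.trans hd⟩
      simpa [hj, hj.trans hd] using this
  rw [hset, Fintype.card_piFinset]
  simp only [apply_ite Finset.card, Finset.card_singleton, Finset.card_univ, Fintype.card_bool]
  rw [Finset.prod_ite, Finset.prod_const_one, Finset.prod_const, one_mul]
  congr 1
  have h2 : (Finset.univ.filter fun j : Fin K => j.val < sDepth s).card = _ :=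
    Fin.card_filter_val_lt
  have h3 := Finset.card_filter_add_card_filter_not (s := (Finset.univ : Finset (Fin K)))
    (fun j : Fin K => j.val < sDepth s)
  simp only [Finset.card_univ, Fintype.card_fin] at h3
  omega

/-- The cycle along a descending path of servers, closed through a server `s` at the depth
of the end of the path. -/
lemma formPerm_path_apply {n : ℕ} (p : ℕ → Fin n) (s : Fin n) (k : ℕ) : ∀ i : ℕ,
    (∀ j ≤ i + k, sDepth (p j) = j) → sDepth s = i + k →
    (List.formPerm ((List.range' i (k + 1)).map p ++ [s]) s = p i) ∧
    ∀ x, x ≠ s → List.formPerm ((List.range' i (k + 1)).map p ++ [s]) x =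
      if i ≤ sDepth x ∧ sDepth x < i + k ∧ p (sDepth x) = x then p (sDepth x + 1)
      else if x = p (i + k) then s else x := by
  induction k with
  | zero =>
    intro i hp hs
    simp only [zero_add, List.range'_one, List.map_cons, List.map_nil, List.singleton_append,
      List.formPerm_pair, Equiv.swap_apply_right, add_zero, true_and]
    intro x hx
    rw [if_neg (by omega), Equiv.swap_apply_def, if_neg hx]
  | succ k ih =>
    intro i hp hs
    obtain ⟨h1, h2⟩ := ih (i + 1) (fun j hj => hp j (by omega)) (by omega)
    have hlist : (List.range' i (k + 1 + 1)).map p ++ [s] =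
        p i :: p (i + 1) :: ((List.range' (i + 1 + 1) k).map p ++ [s]) := by
      simp [List.range'_succ]
    have htail : (List.range' (i + 1) (k + 1)).map p ++ [s] =
        p (i + 1) :: ((List.range' (i + 1 + 1) k).map p ++ [s]) := by
      simp [List.range'_succ]
    rw [hlist, List.formPerm_cons_cons, ← htail]
    have hik : i + 1 + k = i + (k + 1) := by omega
    rw [hik] at h2
    refine ⟨by simp [h1], fun x hx => ?_⟩
    rw [Equiv.Perm.mul_apply, h2 x hx]
    have hdi := hp i (by omega)
    have hdi' := hp (i + 1) (by omega)
    have hdk := hp (i + (k + 1)) le_rfl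
    by_cases hxi : x = p i
    · have hne : x ≠ p (i + (k + 1)) := fun h => by
        have := congrArg sDepth (hxi.symm.trans h); omega
      have hxd : sDepth x = i := by rw [hxi, hdi]
      rw [if_neg (by omega), if_neg hne, if_pos ⟨by omega, by omega, by rw [hxd, hxi]⟩, hxd, hxi,
        Equiv.swap_apply_left]
    · by_cases hcond : i + 1 ≤ sDepth x ∧ sDepth x < i + (k + 1) ∧ p (sDepth x) = x
      · rw [if_pos hcond, if_pos ⟨by omega, hcond.2⟩]
        have hd := hp (sDepth x + 1) (by omega)
        apply Equiv.swap_apply_of_ne_of_ne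
        · intro h; rw [h] at hd; omega
        · intro h; rw [h] at hd; omega
      · have hcond' : ¬ (i ≤ sDepth x ∧ sDepth x < i + (k + 1) ∧ p (sDepth x) = x) := by
          rintro ⟨ha, hb, hc⟩
          rcases ha.eq_or_lt with h | h
          · exact hxi (by rw [← hc, ← h])
          · exact hcond ⟨h, hb, hc⟩
        rw [if_neg hcond, if_neg hcond']
        by_cases hxk : x = p (i + (k + 1))
        · rw [if_pos hxk]
          apply Equiv.swap_apply_of_ne_of_ne
          · intro h; rw [h] at hs; omega
          · intro h
            apply hx
            have : i + 1 = i + (k + 1) := by rw [← hdi', ← h, hs]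
            rw [hxk, h, this]
        · rw [if_neg hxk]
          apply Equiv.swap_apply_of_ne_of_ne hxi
          intro h
          have hxd : sDepth x = i + 1 := by rw [h, hdi']
          rcases Nat.eq_zero_or_pos k with hk | hk
          · exact hxk (by rw [h, hk])
          · exact hcond ⟨by omega, by omega, by rw [hxd, h]⟩

lemma sDepth_rpStep_self {n K : ℕ} (hn : n = 2 ^ K - 1) (hpos : 0 < n) (f : ℕ → Bool)
    (u : Fin n) (c : Fin n ≃ Fin n) : sDepth (rpStep hpos f u c u) = 0 := by
  have hd := depth_lt_of_full_tree hn (c u)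
  rw [rpStep, Equiv.trans_apply, List.range_eq_range',
    (formPerm_path_apply (rpPath hpos f) (c u) (sDepth (c u)) 0
      (fun j hj => sDepth_rpPath hn hpos f (by omega)) (by omega)).1]
  simp [rpPath, sDepth]

lemma sDepth_rpStep_of_ne {n K : ℕ} (hn : n = 2 ^ K - 1) (hpos : 0 < n) (f : ℕ → Bool)
    {u v : Fin n} (c : Fin n ≃ Fin n) (hv : v ≠ u) :
    sDepth (rpStep hpos f u c v) =
      if sDepth (c v) < sDepth (c u) ∧ rpPath hpos f (sDepth (c v)) = c v
      then sDepth (c v) + 1 else sDepth (c v) := by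
  have hd := depth_lt_of_full_tree hn (c u)
  have hp : ∀ j ≤ 0 + sDepth (c u), sDepth (rpPath hpos f j) = j :=
    fun j hj => sDepth_rpPath hn hpos f (by omega)
  rw [rpStep, Equiv.trans_apply, List.range_eq_range',
    (formPerm_path_apply (rpPath hpos f) (c u) (sDepth (c u)) 0 hp (by omega)).2 _
      (c.injective.ne hv)]
  simp only [zero_le, true_and, zero_add]
  split
  · rw [hp _ (by omega)]
  · split
    · rename_i h
      rw [h, hp _ (by omega)]
    · rfl

/-- Contribution to the potential of an item that is not deeper than the observed item,
which sits at depth `d`; `l` is the threshold depth. -/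
noncomputable def behindCost (l d : ℕ) : ℝ :=
  if d ≤ l then (3 - 2 ^ d / 2 ^ l) / 2 ^ l else 2 / 2 ^ d

/-- Contribution to the potential of an item that is deeper than the observed item,
which sits at depth `d`; `l` is the threshold depth. -/
noncomputable def aheadCost (l d : ℕ) : ℝ := 3 / 2 ^ max d l

/-- Contribution to the potential of an item at depth `a` when the observed item is at
depth `d`. -/
noncomputable def pairCost (l a d : ℕ) : ℝ :=
  if a ≤ d then behindCost l d else aheadCost l d

lemma behindCost_of_ge {l d : ℕ} (h : l ≤ d) : behindCost l d = 2 / 2 ^ d := by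
  rcases h.eq_or_lt with rfl | h
  · rw [behindCost, if_pos le_rfl, div_self (by positivity)]
    norm_num
  · rw [behindCost, if_neg (by omega)]

lemma aheadCost_add_behindCost_succ (l d : ℕ) :
    aheadCost l d + behindCost l (d + 1) = 2 * behindCost l d := by
  rcases le_or_gt l d with h | h
  · rw [behindCost_of_ge h, behindCost_of_ge (by omega), aheadCost, max_eq_left h, pow_succ]
    field_simp
    norm_num
  · rw [behindCost, behindCost, if_pos (Nat.succ_le_of_lt h), if_pos h.le, aheadCost,
      max_eq_right h.le, pow_succ]
    field_simp
    ring

lemma aheadCost_succ_le (l d : ℕ) : aheadCost l (d + 1) ≤ aheadCost l d := by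
  rw [aheadCost, aheadCost]
  gcongr
  · norm_num
  · omega

lemma aheadCost_le (l d : ℕ) : aheadCost l d ≤ 3 / 2 ^ l := by
  rw [aheadCost]
  gcongr
  · norm_num
  · exact le_max_right _ _

/-- The cost of a request to a deeper item pays for the expected push of the observed item. -/
lemma behindCost_add_push_le (l d : ℕ) :
    behindCost l d + (if l ≤ d then 1 / 2 ^ d else 0) ≤ aheadCost l d := by
  rcases le_or_gt l d with h | h
  · rw [behindCost_of_ge h, aheadCost, max_eq_left h, if_pos h, ← add_div]
    norm_num
  · rw [behindCost, if_pos h.le, aheadCost, max_eq_right h.le, if_neg (by omega), add_zero]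
    gcongr
    have : (0 : ℝ) ≤ 2 ^ d / 2 ^ l := by positivity
    linarith

lemma behindCost_le_aheadCost (l d : ℕ) : behindCost l d ≤ aheadCost l d := by
  refine le_trans ?_ (behindCost_add_push_le l d)
  have : (0 : ℝ) ≤ if l ≤ d then 1 / 2 ^ d else 0 := by split <;> positivity
  linarith

lemma behindCost_succ_le (l d : ℕ) : behindCost l (d + 1) ≤ behindCost l d := by
  linarith [aheadCost_add_behindCost_succ l d, behindCost_le_aheadCost l d]

lemma pairCost_le_aheadCost (l a d : ℕ) : pairCost l a d ≤ aheadCost l d := by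
  rw [pairCost]
  split
  · exact behindCost_le_aheadCost l d
  · exact le_rfl

lemma pairCost_le (l a d : ℕ) : pairCost l a d ≤ 3 / 2 ^ l :=
  (pairCost_le_aheadCost l a d).trans (aheadCost_le l d)

lemma sum_ite_path_eq {n K : ℕ} (hn : n = 2 ^ K - 1) (hpos : 0 < n) (s : Fin n) (x : ℝ) :
    ∑ η : Fin K → Bool, (if rpPath hpos (flipRow K η) (sDepth s) = s then x else 0) =
      2 ^ K * (x / 2 ^ sDepth s) := by
  have hd := depth_lt_of_full_tree hn s
  rw [← Finset.sum_filter, Finset.sum_const, card_flips_rpPath_eq hn hpos, nsmul_eq_mul]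
  push_cast
  rw [pow_sub₀ _ (by norm_num) hd.le]
  ring

/-- The pair potential of two items, neither of them requested, does not increase in
expectation. -/
lemma sum_pairCost_le_of_ne {n K : ℕ} (hn : n = 2 ^ K - 1) (hpos : 0 < n) (l : ℕ)
    {u v w : Fin n} (c : Fin n ≃ Fin n) (hv : v ≠ u) (hw : w ≠ u) :
    ∑ η : Fin K → Bool, pairCost l (sDepth (rpStep hpos (flipRow K η) u c w))
        (sDepth (rpStep hpos (flipRow K η) u c v)) ≤
      2 ^ K * pairCost l (sDepth (c w)) (sDepth (c v)) := by
  simp only [sDepth_rpStep_of_ne hn hpos _ c hv, sDepth_rpStep_of_ne hn hpos _ c hw]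
  have hconst : (2 : ℝ) ^ K * pairCost l (sDepth (c w)) (sDepth (c v)) =
      ∑ _η : Fin K → Bool, pairCost l (sDepth (c w)) (sDepth (c v)) := by simp
  rcases lt_trichotomy (sDepth (c w)) (sDepth (c v)) with h | h | h
  · rw [hconst]
    refine Finset.sum_le_sum fun η _ => ?_
    have hb := behindCost_succ_le l (sDepth (c v))
    simp only [pairCost, if_pos h.le]
    split_ifs <;> first | omega | linarith
  · by_cases hb : sDepth (c v) < sDepth (c u)
    · have hg := aheadCost_add_behindCost_succ l (sDepth (c v))
      have hsucc := behindCost_succ_le l (sDepth (c v))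
      calc _ ≤ ∑ η : Fin K → Bool, (behindCost l (sDepth (c v)) +
            (if rpPath hpos (flipRow K η) (sDepth (c w)) = c w
              then aheadCost l (sDepth (c v)) - behindCost l (sDepth (c v)) else 0) +
            (if rpPath hpos (flipRow K η) (sDepth (c v)) = c v
              then behindCost l (sDepth (c v)) - aheadCost l (sDepth (c v)) else 0)) := by
            refine Finset.sum_le_sum fun η _ => ?_
            simp only [h, hb, true_and, pairCost]
            split_ifs <;> first | omega | linarith
        _ = _ := by
            rw [Finset.sum_add_distrib, Finset.sum_add_distrib, sum_ite_path_eq hn,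
              sum_ite_path_eq hn, pairCost, if_pos h.le, h]
            simp
            ring
    · rw [hconst]
      refine Finset.sum_le_sum fun η _ => ?_
      rw [if_neg (by omega), if_neg (by omega)]
  · rw [hconst]
    refine Finset.sum_le_sum fun η _ => ?_
    refine (pairCost_le_aheadCost _ _ _).trans ?_
    have hold : pairCost l (sDepth (c w)) (sDepth (c v)) = aheadCost l (sDepth (c v)) :=
      if_neg (by omega)
    rw [hold]
    split
    · exact aheadCost_succ_le _ _
    · exact le_rfl

/-- The expected growth of the depth beyond `l` caused by a request to `u`, together with the
new pair potential of `u`, is paid for by the old pair potential of `u`. -/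
lemma sum_max_sub_add_pairCost_le {n K : ℕ} (hn : n = 2 ^ K - 1) (hpos : 0 < n) (l : ℕ)
    {u v : Fin n} (c : Fin n ≃ Fin n) (hv : v ≠ u) :
    ∑ η : Fin K → Bool, ((max (sDepth (rpStep hpos (flipRow K η) u c v)) l : ℕ) -
        (max (sDepth (c v)) l : ℕ) +
        pairCost l (sDepth (rpStep hpos (flipRow K η) u c u))
          (sDepth (rpStep hpos (flipRow K η) u c v))) ≤
      2 ^ K * pairCost l (sDepth (c u)) (sDepth (c v)) := by
  simp only [sDepth_rpStep_of_ne hn hpos _ c hv, sDepth_rpStep_self hn]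
  by_cases hb : sDepth (c v) < sDepth (c u)
  · calc _ ≤ ∑ η : Fin K → Bool, (behindCost l (sDepth (c v)) +
          (if rpPath hpos (flipRow K η) (sDepth (c v)) = c v
            then (if l ≤ sDepth (c v) then 1 else 0) else 0)) := by
          refine Finset.sum_le_sum fun η _ => ?_
          have hg := behindCost_succ_le l (sDepth (c v))
          simp only [hb, true_and, pairCost, zero_le, if_true]
          split_ifs with h1 h2
          · rw [max_eq_left h2, max_eq_left (by omega)]
            push_cast
            linarith
          · rw [max_eq_right (by omega), max_eq_right (by omega)]
            linarith
          · linarith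
      _ = 2 ^ K * (behindCost l (sDepth (c v)) +
            (if l ≤ sDepth (c v) then 1 / 2 ^ sDepth (c v) else 0)) := by
          rw [Finset.sum_add_distrib, sum_ite_path_eq hn]
          split_ifs
          · simp [mul_add]
          · simp
      _ ≤ _ := by
          have hold : pairCost l (sDepth (c u)) (sDepth (c v)) = aheadCost l (sDepth (c v)) :=
            if_neg (by omega)
          rw [hold]
          gcongr
          exact behindCost_add_push_le _ _
  · simp [hb, pairCost, not_lt.1 hb]

/-- The potential of the observed item `v` with respect to a set `S` of items. -/
noncomputable def pushPotential {n : ℕ} (l : ℕ) (v : Fin n) (S : Finset (Fin n))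
    (c : Fin n ≃ Fin n) : ℝ :=
  (max (sDepth (c v)) l : ℕ) + ∑ w ∈ S, pairCost l (sDepth (c w)) (sDepth (c v))

lemma behindCost_nonneg (l d : ℕ) : 0 ≤ behindCost l d := by
  rw [behindCost]
  split_ifs with h
  · have : (2 : ℝ) ^ d / 2 ^ l ≤ 1 :=
      div_le_one_of_le₀ (pow_le_pow_right₀ (by norm_num) h) (by positivity)
    exact div_nonneg (by linarith) (by positivity)
  · positivity

lemma pairCost_nonneg (l a d : ℕ) : 0 ≤ pairCost l a d := by
  rw [pairCost]
  split
  · exact behindCost_nonneg l d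
  · exact (behindCost_nonneg l d).trans (behindCost_le_aheadCost l d)

lemma depth_le_pushPotential {n : ℕ} (l : ℕ) (v : Fin n) (S : Finset (Fin n))
    (c : Fin n ≃ Fin n) : (sDepth (c v) : ℝ) ≤ pushPotential l v S c := by
  have h1 : (sDepth (c v) : ℝ) ≤ (max (sDepth (c v)) l : ℕ) := by
    exact_mod_cast le_max_left _ _
  have h2 := Finset.sum_nonneg fun w (_ : w ∈ S) =>
    pairCost_nonneg l (sDepth (c w)) (sDepth (c v))
  rw [pushPotential]
  linarith

lemma sum_pushPotential_insert_le {n K : ℕ} (hn : n = 2 ^ K - 1) (hpos : 0 < n) (l : ℕ)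
    {u v : Fin n} (c : Fin n ≃ Fin n) (hv : v ≠ u) (S : Finset (Fin n)) :
    ∑ η : Fin K → Bool, pushPotential l v (insert u S) (rpStep hpos (flipRow K η) u c) ≤
      2 ^ K * (pushPotential l v S c + if u ∈ S then 0 else 3 / 2 ^ l) := by
  have hins : insert u S = insert u (S.erase u) := by
    ext x
    by_cases hx : x = u <;> simp [hx]
  have hold : pairCost l (sDepth (c u)) (sDepth (c v)) +
      ((max (sDepth (c v)) l : ℕ) + ∑ w ∈ S.erase u, pairCost l (sDepth (c w)) (sDepth (c v))) ≤
      pushPotential l v S c + if u ∈ S then 0 else 3 / 2 ^ l := by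
    rw [pushPotential]
    split_ifs with hu
    · rw [← Finset.add_sum_erase _ _ hu]
      linarith
    · rw [Finset.erase_eq_of_notMem hu]
      linarith [pairCost_le l (sDepth (c u)) (sDepth (c v))]
  refine le_trans ?_ (mul_le_mul_of_nonneg_left hold (by positivity))
  have hnew : ∀ η : Fin K → Bool,
      pushPotential l v (insert u S) (rpStep hpos (flipRow K η) u c) =
      ((max (sDepth (rpStep hpos (flipRow K η) u c v)) l : ℕ) -
        (max (sDepth (c v)) l : ℕ) +
        pairCost l (sDepth (rpStep hpos (flipRow K η) u c u))
          (sDepth (rpStep hpos (flipRow K η) u c v))) +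
      (max (sDepth (c v)) l : ℕ) +
      ∑ w ∈ S.erase u, pairCost l (sDepth (rpStep hpos (flipRow K η) u c w))
          (sDepth (rpStep hpos (flipRow K η) u c v)) := by
    intro η
    rw [hins, pushPotential, Finset.sum_insert (Finset.notMem_erase u S)]
    ring
  simp only [hnew]
  rw [Finset.sum_add_distrib, Finset.sum_add_distrib, Finset.sum_comm, mul_add, mul_add,
    Finset.mul_sum, ← add_assoc]
  refine add_le_add (add_le_add (sum_max_sub_add_pairCost_le hn hpos l c hv) (by simp))
    (Finset.sum_le_sum fun w hw => ?_)
  exact sum_pairCost_le_of_ne hn hpos l c hv (Finset.mem_erase.1 hw).1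

lemma one_le_itemRank {n : ℕ} (r0 : Fin n ≃ Fin n) (σ : ℕ → Fin n) (t : ℕ) (v : Fin n) :
    1 ≤ itemRank r0 σ t v := by
  cases t with
  | zero => simp [itemRank]
  | succ t =>
    have := one_le_itemRank r0 σ t v
    simp only [itemRank]
    split_ifs <;> omega

lemma itemRank_injective {n : ℕ} (r0 : Fin n ≃ Fin n) (σ : ℕ → Fin n) (t : ℕ) :
    Function.Injective (itemRank r0 σ t) := by
  induction t with
  | zero =>
    intro v w h
    simp only [itemRank] at h
    exact r0.injective (Fin.ext (by omega))
  | succ t ih =>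
    intro v w h
    have h1 := one_le_itemRank r0 σ t v
    have h2 := one_le_itemRank r0 σ t w
    have h5 := one_le_itemRank r0 σ t (σ t)
    have h3 := fun hne : v ≠ σ t => ih.ne hne
    have h4 := fun hne : w ≠ σ t => ih.ne hne
    simp only [itemRank] at h
    by_cases hv : v = σ t <;> by_cases hw : w = σ t <;> simp only [hv, hw, if_true, if_false] at h
    · rw [hv, hw]
    · have := h4 hw
      split_ifs at h <;> omega
    · have := h3 hv
      split_ifs at h <;> omega
    · have := h3 hv
      have := h4 hw
      apply ih
      split_ifs at h <;> omega

/-- The items of rank smaller than `v` at time `t`. -/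
def recentItems {n : ℕ} (r0 : Fin n ≃ Fin n) (σ : ℕ → Fin n) (t : ℕ) (v : Fin n) :
    Finset (Fin n) :=
  Finset.univ.filter fun w => itemRank r0 σ t w < itemRank r0 σ t v

lemma card_recentItems_lt {n : ℕ} (r0 : Fin n ≃ Fin n) (σ : ℕ → Fin n) (t : ℕ) (v : Fin n) :
    (recentItems r0 σ t v).card < itemRank r0 σ t v := by
  have h := Finset.card_le_card_of_injOn (s := recentItems r0 σ t v)
    (t := Finset.Ico 1 (itemRank r0 σ t v)) (itemRank r0 σ t)
    (fun w hw => Finset.mem_coe.2 <| Finset.mem_Ico.2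
      ⟨one_le_itemRank r0 σ t w, (Finset.mem_filter.1 hw).2⟩)
    (itemRank_injective r0 σ t).injOn
  have := one_le_itemRank r0 σ t v
  rw [Nat.card_Ico] at h
  omega

lemma recentItems_succ_self {n : ℕ} (r0 : Fin n ≃ Fin n) (σ : ℕ → Fin n) (t : ℕ) :
    recentItems r0 σ (t + 1) (σ t) = ∅ := by
  refine Finset.filter_eq_empty_iff.2 fun w _ => ?_
  have := one_le_itemRank r0 σ (t + 1) w
  simp only [itemRank, if_true] at this ⊢
  omega

lemma recentItems_succ_of_ne {n : ℕ} (r0 : Fin n ≃ Fin n) (σ : ℕ → Fin n) (t : ℕ)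
    {v : Fin n} (hv : v ≠ σ t) :
    recentItems r0 σ (t + 1) v = insert (σ t) (recentItems r0 σ t v) := by
  ext w
  have h1 := one_le_itemRank r0 σ t (σ t)
  have h2 := (itemRank_injective r0 σ t).ne hv
  have h3 := one_le_itemRank r0 σ t v
  simp only [recentItems, Finset.mem_filter_univ, Finset.mem_insert, itemRank, if_neg hv]
  by_cases hw : w = σ t
  · simp only [hw, if_true, true_or, iff_true]
    split_ifs <;> omega
  · have := (itemRank_injective r0 σ t).ne hw
    simp only [hw, if_false, false_or]
    split_ifs <;> omega

lemma itemRank_le_succ {n : ℕ} (r0 : Fin n ≃ Fin n) (σ : ℕ → Fin n) (t : ℕ)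
    {v : Fin n} (hv : v ≠ σ t) : itemRank r0 σ t v ≤ itemRank r0 σ (t + 1) v := by
  simp only [itemRank, if_neg hv]
  split_ifs <;> omega

lemma rpConf_congr {n : ℕ} (hpos : 0 < n) (c0 : Fin n ≃ Fin n) (σ : ℕ → Fin n)
    {ω ω' : ℕ → ℕ → Bool} (t : ℕ) (h : ∀ s < t, ω s = ω' s) :
    rpConf hpos c0 σ ω t = rpConf hpos c0 σ ω' t := by
  induction t with
  | zero => rfl
  | succ t ih => rw [rpConf, rpConf, ih fun s hs => h s (by omega), h t (by omega)]

lemma sum_rpConf_succ {n K : ℕ} (hpos : 0 < n) (c0 : Fin n ≃ Fin n) (σ : ℕ → Fin n) (t : ℕ)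
    (F : (Fin n ≃ Fin n) → ℝ) :
    ∑ ω : Fin (t + 1) → Fin K → Bool, F (rpConf hpos c0 σ (extendFlips (t + 1) K ω) (t + 1)) =
      ∑ ω : Fin t → Fin K → Bool, ∑ η : Fin K → Bool,
        F (rpStep hpos (flipRow K η) (σ t) (rpConf hpos c0 σ (extendFlips t K ω) t)) := by
  rw [← (Fin.snocEquiv fun _ : Fin (t + 1) => Fin K → Bool).sum_comp, Fintype.sum_prod_type_right]
  refine Finset.sum_congr rfl fun ω _ => Finset.sum_congr rfl fun η _ => ?_
  have hlast : extendFlips (t + 1) K (Fin.snoc ω η : Fin (t + 1) → Fin K → Bool) t =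
      flipRow K η := by
    funext j
    simp only [extendFlips, flipRow, Nat.lt_succ_self, true_and]
    split
    · simp [Fin.snoc]
    · rfl
  have hinit : ∀ s < t, extendFlips (t + 1) K (Fin.snoc ω η : Fin (t + 1) → Fin K → Bool) s =
      extendFlips t K ω s := by
    intro s hs
    funext j
    simp only [extendFlips, hs, hs.trans (Nat.lt_succ_self t), true_and]
    split
    · simp [Fin.snoc, hs]
    · rfl
  simp only [Fin.snocEquiv, Equiv.coe_fn_mk]
  rw [rpConf, hlast, rpConf_congr hpos c0 σ t hinit]

lemma sum_pushPotential_rpConf_le {n K : ℕ} (hn : n = 2 ^ K - 1) (hpos : 0 < n)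
    (r0 : Fin n ≃ Fin n) (σ : ℕ → Fin n) (c0 : Fin n ≃ Fin n)
    (hinit : ∀ v : Fin n, sDepth (c0 v) = Nat.log 2 (itemRank r0 σ 0 v)) (l t : ℕ) :
    ∀ v : Fin n, itemRank r0 σ t v ≤ 2 ^ l →
    ∑ ω : Fin t → Fin K → Bool,
        pushPotential l v (recentItems r0 σ t v) (rpConf hpos c0 σ (extendFlips t K ω) t) ≤
      (2 ^ K) ^ t * (l + (recentItems r0 σ t v).card * (3 / 2 ^ l)) := by
  induction t with
  | zero =>
    intro v hv
    have hd : sDepth (c0 v) ≤ l := by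
      rw [hinit]
      exact (Nat.log_mono_right hv).trans (Nat.log_pow (by norm_num) l).le
    simp only [Finset.univ_unique, Finset.sum_singleton, rpConf, pow_zero, one_mul, pushPotential,
      max_eq_right hd]
    gcongr
    rw [← nsmul_eq_mul]
    exact Finset.sum_le_card_nsmul _ _ _ fun w _ => pairCost_le _ _ _
  | succ t ih =>
    intro v hv
    rw [sum_rpConf_succ hpos c0 σ t
      (fun c => pushPotential l v (recentItems r0 σ (t + 1) v) c)]
    by_cases hvt : v = σ t
    · subst hvt
      simp [recentItems_succ_self, pushPotential, sDepth_rpStep_self hn, pow_succ]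
      ring_nf
      rfl
    · rw [recentItems_succ_of_ne r0 σ t hvt]
      refine (Finset.sum_le_sum fun ω _ =>
        sum_pushPotential_insert_le hn hpos l _ hvt _).trans ?_
      rw [← Finset.mul_sum, Finset.sum_add_distrib, Finset.sum_const, nsmul_eq_mul,
        Finset.card_univ, Fintype.card_pi_const, Fintype.card_pi_const, Fintype.card_bool]
      have hi := ih v ((itemRank_le_succ r0 σ t hvt).trans hv)
      have hcard : ((insert (σ t) (recentItems r0 σ t v)).card : ℝ) * (3 / 2 ^ l) =
          (recentItems r0 σ t v).card * (3 / 2 ^ l) +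
            if σ t ∈ recentItems r0 σ t v then 0 else 3 / 2 ^ l := by
        rw [Finset.card_insert_eq_ite]
        split_ifs
        · simp
        · push_cast
          ring
      rw [hcard, pow_succ', mul_assoc]
      push_cast
      refine mul_le_mul_of_nonneg_left ?_ (by positivity)
      linarith

lemma clog_add_lt_logb_add_three {r : ℕ} (hr : 1 ≤ r) :
    (Nat.clog 2 r : ℝ) + (r - 1) * (3 / 2 ^ Nat.clog 2 r) < Real.logb 2 r + 3 := by
  have hr' : (0 : ℝ) < r := by exact_mod_cast hr
  set y : ℝ := 2 ^ Nat.clog 2 r / r with hy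
  have hy1 : 1 ≤ y := by
    rw [hy, one_le_div hr']
    exact_mod_cast Nat.le_pow_clog (by norm_num) r
  have hy2 : y ≤ 2 := by
    rw [hy, div_le_iff₀ hr']
    rcases hr.eq_or_lt with rfl | h
    · simp
    · have h1 := Nat.pow_pred_clog_lt_self (b := 2) (by norm_num) h
      have h2 : 0 < Nat.clog 2 r := Nat.clog_pos (by norm_num) h
      have h3 : 2 ^ Nat.clog 2 r ≤ 2 * r := by
        rw [← Nat.succ_pred_eq_of_pos h2, pow_succ]
        omega
      exact_mod_cast h3
  have hy0 : 0 < y := by linarith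
  have hlog : Real.logb 2 y = Nat.clog 2 r - Real.logb 2 r := by
    rw [hy, Real.logb_div (by positivity) hr'.ne', Real.logb_pow,
      Real.logb_self_eq_one (by norm_num), mul_one]
  have hz : (2 : ℝ) ^ Nat.clog 2 r = y * r := by rw [hy]; field_simp
  have hl2 : (2 : ℝ) ≤ 3 * Real.log 2 := by linarith [Real.log_two_gt_d9]
  have hpos : 0 < Real.log 2 := Real.log_pos (by norm_num)
  have hkey : Real.logb 2 y ≤ 3 * ((y - 1) / y) := by
    rw [Real.logb, div_le_iff₀ hpos]
    have h1 : Real.log y ≤ y - 1 := Real.log_le_sub_one_of_pos hy0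
    have h2 : y - 1 ≤ 2 * ((y - 1) / y) := by
      rw [← mul_div_assoc, le_div_iff₀ hy0]
      nlinarith
    have h3 : 0 ≤ (y - 1) / y := div_nonneg (by linarith) hy0.le
    nlinarith
  have hstrict : ((r : ℝ) - 1) * (3 / (y * r)) < 3 - 3 * ((y - 1) / y) := by
    have : 3 - 3 * ((y - 1) / y) - ((r : ℝ) - 1) * (3 / (y * r)) = 3 / (y * r) := by
      field_simp
      ring
    have : 0 < 3 / (y * r) := by positivity
    linarith
  rw [hz]
  linarith

/-- The Random-Push algorithm maintains an `MRU(4)` tree in expectation: for every request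
sequence `σ` and every time `t`, the expected depth (over the uniformly random coin
flips, i.e. the uniform average over all finite flip tables) of the item `v` of rank
`r` at time `t` in Random-Push's tree satisfies `E[D(r)] < log₂ r + 3`
(and hence `E[D(r)] < ⌊log₂ r⌋ + 4`). -/
theorem randompush_maintains_mru4_in_expectation
    (K : ℕ) (hK : 1 ≤ K) (n : ℕ) (hn : n = 2 ^ K - 1) (hpos : 0 < n)
    (r0 : Fin n ≃ Fin n) (σ : ℕ → Fin n) (c0 : Fin n ≃ Fin n)
    (hinit : ∀ v : Fin n, sDepth (c0 v) = Nat.log 2 (itemRank r0 σ 0 v))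
    (t : ℕ) (v : Fin n) (r : ℕ) (hr : itemRank r0 σ t v = r) :
    (∑ ω : Fin t → Fin K → Bool,
          (sDepth (rpConf hpos c0 σ (extendFlips t K ω) t v) : ℝ))
        / (Fintype.card (Fin t → Fin K → Bool) : ℝ)
      < Real.logb 2 r + 3 ∧
    (∑ ω : Fin t → Fin K → Bool,
          (sDepth (rpConf hpos c0 σ (extendFlips t K ω) t v) : ℝ))
        / (Fintype.card (Fin t → Fin K → Bool) : ℝ)
      < (Nat.log 2 r : ℝ) + 4 := by
  have hr1 : 1 ≤ r := hr ▸ one_le_itemRank r0 σ t v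
  have hcard := card_recentItems_lt r0 σ t v
  rw [hr] at hcard
  have hcard' : ((recentItems r0 σ t v).card : ℝ) ≤ r - 1 := by
    have : ((recentItems r0 σ t v).card : ℝ) + 1 ≤ r := by exact_mod_cast hcard
    linarith
  have hpot := sum_pushPotential_rpConf_le hn hpos r0 σ c0 hinit (Nat.clog 2 r) t v
    (hr ▸ Nat.le_pow_clog (by norm_num) _)
  have hmain : (∑ ω : Fin t → Fin K → Bool,
          (sDepth (rpConf hpos c0 σ (extendFlips t K ω) t v) : ℝ))
        / (Fintype.card (Fin t → Fin K → Bool) : ℝ) < Real.logb 2 r + 3 := by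
    refine lt_of_le_of_lt ?_ (clog_add_lt_logb_add_three hr1)
    rw [Fintype.card_pi_const, Fintype.card_pi_const, Fintype.card_bool,
      div_le_iff₀ (by positivity)]
    refine (Finset.sum_le_sum fun ω _ => depth_le_pushPotential (Nat.clog 2 r) v
      (recentItems r0 σ t v) _).trans (hpot.trans ?_)
    push_cast
    rw [mul_comm]
    gcongr
  refine ⟨hmain, hmain.trans ?_⟩
  have hlog : Real.logb 2 r < Nat.log 2 r + 1 := by
    rw [Real.logb_lt_iff_lt_rpow (by norm_num) (by exact_mod_cast hr1)]
    exact_mod_cast Nat.lt_pow_succ_log_self (b := 2) (by norm_num) r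
  linarith
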